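/- arXiv:2310.19369 — 2 statements merged into one kernel-verified Lean document; each statement's English description precedes it below -/
import Mathlib

section
/- Fix 0 ≤ C_w ≤ C_t ≤ C_n and P̄_t ≥ 0, and let V(D, A) be the hourly economic dispatch value function. Let (D_k, A_k), k = 1, …, K, be hourly data with D_k ≥ 0, A_k ≥ 0, and let {G_1, …, G_m} be a partition of {1, …, K} such that for each cluster G_j the set {(D_k, A_k) : k ∈ G_j} is contained in one of the three regimes R₁ = {0 ≤ D ≤ A}, R₂ = {0 ≤ A ≤ D ≤ A + P̄_t}, R₃ = {A ≥ 0, D ≥ A + P̄_t}. Then the full hourly cost equals the weighted cost of the centroid representatives: ∑_{k=1}^K V(D_k, A_k) = ∑_{j=1}^m |G_j| · V(D̄_j, Ā_j), where (D̄_j, Ā_j) = (1/|G_j|) ∑_{k∈G_j} (D_k, A_k). -/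
/-- The hourly economic dispatch value function `V(D, A)`. -/
noncomputable def dispatchValue (Cw Ct Cn Pt D A : ℝ) : ℝ :=
  sInf {c : ℝ | ∃ pw pt n : ℝ, pw + pt + n = D ∧ 0 ≤ pw ∧ pw ≤ A ∧ 0 ≤ pt ∧ pt ≤ Pt ∧
    0 ≤ n ∧ c = Cw * pw + Ct * pt + Cn * n}

/-- Regime 1 (wind marginal): `0 ≤ D ≤ A`. -/
def regime1 (Pt : ℝ) : Set (ℝ × ℝ) := {p : ℝ × ℝ | 0 ≤ p.1 ∧ p.1 ≤ p.2}

/-- Regime 2 (thermal marginal): `0 ≤ A ≤ D ≤ A + P̄t`. -/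
def regime2 (Pt : ℝ) : Set (ℝ × ℝ) :=
  {p : ℝ × ℝ | 0 ≤ p.2 ∧ p.2 ≤ p.1 ∧ p.1 ≤ p.2 + Pt}

/-- Regime 3 (non-supplied power marginal): `A ≥ 0`, `D ≥ A + P̄t`. -/
def regime3 (Pt : ℝ) : Set (ℝ × ℝ) := {p : ℝ × ℝ | 0 ≤ p.2 ∧ p.2 + Pt ≤ p.1}

theorem dispatchValue_eq_of_mem_regime1 {Cw Ct Cn Pt D A : ℝ} (hCwt : Cw ≤ Ct) (hCtn : Ct ≤ Cn)
    (hPt : 0 ≤ Pt) (h : (D, A) ∈ regime1 Pt) :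
    dispatchValue Cw Ct Cn Pt D A = Cw * D := by
  obtain ⟨hD, hDA⟩ : 0 ≤ D ∧ D ≤ A := h
  refine IsLeast.csInf_eq ⟨⟨D, 0, 0, by ring, hD, hDA, le_rfl, hPt, le_rfl, by ring⟩, ?_⟩
  rintro _ ⟨pw, pt, n, rfl, -, -, hpt, -, hn, rfl⟩
  nlinarith [mul_nonneg (sub_nonneg.2 hCwt) hpt, mul_nonneg (sub_nonneg.2 (hCwt.trans hCtn)) hn]

theorem dispatchValue_eq_of_mem_regime2 {Cw Ct Cn Pt D A : ℝ} (hCwt : Cw ≤ Ct) (hCtn : Ct ≤ Cn)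
    (h : (D, A) ∈ regime2 Pt) :
    dispatchValue Cw Ct Cn Pt D A = Cw * A + Ct * (D - A) := by
  obtain ⟨hA, hAD, hDP⟩ : 0 ≤ A ∧ A ≤ D ∧ D ≤ A + Pt := h
  refine IsLeast.csInf_eq ⟨⟨A, D - A, 0, by ring, hA, le_rfl, by linarith, by linarith, le_rfl,
    by ring⟩, ?_⟩
  rintro _ ⟨pw, pt, n, rfl, -, hpw, -, -, hn, rfl⟩
  nlinarith [mul_nonneg (sub_nonneg.2 hCwt) (sub_nonneg.2 hpw), mul_nonneg (sub_nonneg.2 hCtn) hn]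

theorem dispatchValue_eq_of_mem_regime3 {Cw Ct Cn Pt D A : ℝ} (hCwt : Cw ≤ Ct) (hCtn : Ct ≤ Cn)
    (hPt : 0 ≤ Pt) (h : (D, A) ∈ regime3 Pt) :
    dispatchValue Cw Ct Cn Pt D A = Cw * A + Ct * Pt + Cn * (D - A - Pt) := by
  obtain ⟨hA, hAD⟩ : 0 ≤ A ∧ A + Pt ≤ D := h
  refine IsLeast.csInf_eq ⟨⟨A, Pt, D - A - Pt, by ring, hA, le_rfl, hPt, le_rfl, by linarith,
    by ring⟩, ?_⟩
  rintro _ ⟨pw, pt, n, rfl, -, hpw, -, hpt, -, rfl⟩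
  nlinarith [mul_nonneg (sub_nonneg.2 (hCwt.trans hCtn)) (sub_nonneg.2 hpw),
    mul_nonneg (sub_nonneg.2 hCtn) (sub_nonneg.2 hpt)]

theorem convex_regime1 (Pt : ℝ) : Convex ℝ (regime1 Pt) := by
  rintro ⟨x, y⟩ ⟨hx, hxy⟩ ⟨x', y'⟩ ⟨hx', hxy'⟩ a b ha hb -
  simp only [regime1, Set.mem_ofPred_eq, Prod.smul_mk, Prod.mk_add_mk, smul_eq_mul] at *
  exact ⟨by positivity, by gcongr⟩

theorem convex_regime2 (Pt : ℝ) : Convex ℝ (regime2 Pt) := by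
  rintro ⟨x, y⟩ ⟨hy, hyx, hx⟩ ⟨x', y'⟩ ⟨hy', hyx', hx'⟩ a b ha hb hab
  simp only [regime2, Set.mem_ofPred_eq, Prod.smul_mk, Prod.mk_add_mk, smul_eq_mul] at *
  refine ⟨by positivity, by gcongr, ?_⟩
  obtain rfl : b = 1 - a := by linarith
  nlinarith [mul_le_mul_of_nonneg_left hx ha, mul_le_mul_of_nonneg_left hx' hb]

theorem convex_regime3 (Pt : ℝ) : Convex ℝ (regime3 Pt) := by
  rintro ⟨x, y⟩ ⟨hy, hx⟩ ⟨x', y'⟩ ⟨hy', hx'⟩ a b ha hb hab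
  simp only [regime3, Set.mem_ofPred_eq, Prod.smul_mk, Prod.mk_add_mk, smul_eq_mul] at *
  refine ⟨by positivity, ?_⟩
  obtain rfl : b = 1 - a := by linarith
  nlinarith [mul_le_mul_of_nonneg_left hx ha, mul_le_mul_of_nonneg_left hx' hb]

/-- A function that is affine on a convex set has, over a finite family of points of that set,
total equal to the number of points times its value at their centroid. -/
theorem sum_eq_card_mul_centroid_of_affine_on {ι : Type*} {S : Set (ℝ × ℝ)} (hS : Convex ℝ S)
    {V : ℝ → ℝ → ℝ} {a b c : ℝ} (hV : ∀ x y, (x, y) ∈ S → V x y = a * x + b * y + c)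
    {s : Finset ι} (hs : s.Nonempty) {x y : ι → ℝ} (hxy : ∀ i ∈ s, (x i, y i) ∈ S) :
    ∑ i ∈ s, V (x i) (y i) =
      (s.card : ℝ) * V ((∑ i ∈ s, x i) / s.card) ((∑ i ∈ s, y i) / s.card) := by
  have hcard : (s.card : ℝ) ≠ 0 := by exact_mod_cast hs.card_pos.ne'
  have hmem : ((∑ i ∈ s, x i) / (s.card : ℝ), (∑ i ∈ s, y i) / (s.card : ℝ)) ∈ S := by
    have h := hS.sum_mem (t := s) (w := fun _ => (s.card : ℝ)⁻¹) (z := fun i => (x i, y i))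
      (fun _ _ => by positivity) (by simp [hcard]) hxy
    convert h using 1
    ext <;> simp [Prod.fst_sum, Prod.snd_sum, ← Finset.mul_sum, div_eq_inv_mul]
  rw [hV _ _ hmem, Finset.sum_congr rfl fun i hi => hV _ _ (hxy i hi)]
  simp only [Finset.sum_add_distrib, ← Finset.mul_sum, Finset.sum_const, nsmul_eq_mul]
  field_simp

/-- Zero-error property of Basis-Oriented TSA for economic dispatch: if the hourly data
are partitioned into clusters `G 1, …, G m`, each of which maps entirely into a single
regime (Simplex basis), then the full hourly cost equals the weighted cost of the
centroid representatives. -/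
theorem basis_oriented_aggregation_exact
    (Cw Ct Cn Pt : ℝ) (hCw : 0 ≤ Cw) (hCwt : Cw ≤ Ct) (hCtn : Ct ≤ Cn) (hPt : 0 ≤ Pt)
    (K m : ℕ) (D A : Fin K → ℝ) (hD : ∀ k, 0 ≤ D k) (hA : ∀ k, 0 ≤ A k)
    (G : Fin m → Finset (Fin K))
    (hne : ∀ j, (G j).Nonempty)
    (hdisj : ∀ j j', j ≠ j' → Disjoint (G j) (G j'))
    (hcover : ∀ k : Fin K, ∃ j, k ∈ G j)
    (hregime : ∀ j, (∀ k ∈ G j, (D k, A k) ∈ regime1 Pt) ∨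
                    (∀ k ∈ G j, (D k, A k) ∈ regime2 Pt) ∨
                    (∀ k ∈ G j, (D k, A k) ∈ regime3 Pt)) :
    ∑ k, dispatchValue Cw Ct Cn Pt (D k) (A k) =
      ∑ j, ((G j).card : ℝ) *
        dispatchValue Cw Ct Cn Pt
          ((∑ k ∈ G j, D k) / (G j).card) ((∑ k ∈ G j, A k) / (G j).card) := by
  have hpart : (Finset.univ : Finset (Fin K)) = Finset.univ.biUnion G := by
    ext k
    simpa using hcover k
  rw [hpart, Finset.sum_biUnion fun j _ j' _ h => hdisj j j' h]
  refine Finset.sum_congr rfl fun j _ => ?_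
  rcases hregime j with h | h | h
  · refine sum_eq_card_mul_centroid_of_affine_on (convex_regime1 Pt) (a := Cw) (b := 0) (c := 0)
      (fun x y hxy => ?_) (hne j) h
    rw [dispatchValue_eq_of_mem_regime1 hCwt hCtn hPt hxy]
    ring
  · refine sum_eq_card_mul_centroid_of_affine_on (convex_regime2 Pt) (a := Ct) (b := Cw - Ct)
      (c := 0) (fun x y hxy => ?_) (hne j) h
    rw [dispatchValue_eq_of_mem_regime2 hCwt hCtn hxy]
    ring
  · refine sum_eq_card_mul_centroid_of_affine_on (convex_regime3 Pt) (a := Cn) (b := Cw - Cn)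
      (c := (Ct - Cn) * Pt) (fun x y hxy => ?_) (hne j) h
    rw [dispatchValue_eq_of_mem_regime3 hCwt hCtn hPt hxy]
    ring
end

section
/- Let A be an m × n real matrix, c ∈ ℝⁿ, and y ∈ ℝᵐ with Aᵀ y ≤ c componentwise. Suppose b₁, …, b_K ∈ ℝᵐ and x₁, …, x_K ≥ 0 satisfy A x_k = b_k and c·x_k = y·b_k for every k (a common optimal dual vector for all K right-hand sides). Let b̄ = (1/K) ∑_k b_k be the centroid. Then x̄ = (1/K) ∑_k x_k is an optimal solution for b̄, the optimal value satisfies inf { c·x : A x = b̄, x ≥ 0 } = y·b̄, and the full total cost equals the weighted aggregated cost: ∑_{k=1}^K c·x_k = K · inf { c·x : A x = b̄, x ≥ 0 }. -/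
open Matrix

/-- The parametric optimal value function `V(b)` of a standard-form linear program
`min c·x  s.t.  A x = b, x ≥ 0`. -/
noncomputable def lpValue {m n : ℕ} (A : Matrix (Fin m) (Fin n) ℝ)
    (c : Fin n → ℝ) (b : Fin m → ℝ) : ℝ :=
  sInf {v : ℝ | ∃ x : Fin n → ℝ, A *ᵥ x = b ∧ 0 ≤ x ∧ v = c ⬝ᵥ x}

/-- Weak duality. -/
theorem dotProduct_le_of_dual_feasible {m n : ℕ} {A : Matrix (Fin m) (Fin n) ℝ}
    {c : Fin n → ℝ} {y : Fin m → ℝ} (hdual : Aᵀ *ᵥ y ≤ c)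
    {x : Fin n → ℝ} (hx : 0 ≤ x) : y ⬝ᵥ (A *ᵥ x) ≤ c ⬝ᵥ x := by
  rw [dotProduct_mulVec, ← mulVec_transpose]
  exact dotProduct_le_dotProduct_of_nonneg_right hdual hx

/-- A dual feasible vector with zero duality gap certifies the optimal value. -/
theorem lpValue_eq_of_dual_feasible {m n : ℕ} {A : Matrix (Fin m) (Fin n) ℝ}
    {c : Fin n → ℝ} {y : Fin m → ℝ} (hdual : Aᵀ *ᵥ y ≤ c)
    {b : Fin m → ℝ} {x : Fin n → ℝ} (hx : 0 ≤ x) (hfeas : A *ᵥ x = b)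
    (hgap : c ⬝ᵥ x = y ⬝ᵥ b) : lpValue A c b = y ⬝ᵥ b := by
  refine IsLeast.csInf_eq ⟨⟨x, hfeas, hx, hgap.symm⟩, ?_⟩
  rintro v ⟨z, rfl, hz, rfl⟩
  exact dotProduct_le_of_dual_feasible hdual hz

/-- General zero-error theorem behind Basis-Oriented TSA: if right-hand sides
`b₁, …, b_K` share a common optimal dual vector `y` (with primal optima `x₁, …, x_K`
exhibiting zero duality gap), then the average `x̄` of the primal optima is optimal for
the centroid `b̄ = (1/K) ∑ₖ bₖ`, the optimal value at `b̄` equals `y·b̄`, and the full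
total cost equals `K` times the aggregated (centroid) cost. -/
theorem lp_centroid_aggregation_exact
    (m n K : ℕ) (hK : 0 < K)
    (A : Matrix (Fin m) (Fin n) ℝ) (c : Fin n → ℝ) (y : Fin m → ℝ)
    (hdual : Aᵀ *ᵥ y ≤ c)
    (b : Fin K → (Fin m → ℝ)) (x : Fin K → (Fin n → ℝ))
    (hx0 : ∀ k, 0 ≤ x k) (hfeas : ∀ k, A *ᵥ x k = b k)
    (hgap : ∀ k, c ⬝ᵥ x k = y ⬝ᵥ b k) :
    (A *ᵥ ((1 / (K : ℝ)) • ∑ k, x k) = (1 / (K : ℝ)) • ∑ k, b k ∧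
      0 ≤ (1 / (K : ℝ)) • ∑ k, x k ∧
      c ⬝ᵥ ((1 / (K : ℝ)) • ∑ k, x k) = lpValue A c ((1 / (K : ℝ)) • ∑ k, b k)) ∧
    lpValue A c ((1 / (K : ℝ)) • ∑ k, b k) = y ⬝ᵥ ((1 / (K : ℝ)) • ∑ k, b k) ∧
    ∑ k, c ⬝ᵥ x k = (K : ℝ) * lpValue A c ((1 / (K : ℝ)) • ∑ k, b k) := by
  have hK' : (K : ℝ) ≠ 0 := by positivity
  have hfeas' : A *ᵥ ((1 / (K : ℝ)) • ∑ k, x k) = (1 / (K : ℝ)) • ∑ k, b k := by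
    simp only [mulVec_smul, mulVec_sum, hfeas]
  have hx' : 0 ≤ (1 / (K : ℝ)) • ∑ k, x k :=
    smul_nonneg (by positivity) (Finset.sum_nonneg fun k _ => hx0 k)
  have hgap' : c ⬝ᵥ ((1 / (K : ℝ)) • ∑ k, x k) = y ⬝ᵥ ((1 / (K : ℝ)) • ∑ k, b k) := by
    simp only [dotProduct_smul, dotProduct_sum, hgap]
  have hval := lpValue_eq_of_dual_feasible hdual hx' hfeas' hgap'
  refine ⟨⟨hfeas', hx', hgap'.trans hval.symm⟩, hval, ?_⟩
  rw [hval, ← hgap', dotProduct_smul, dotProduct_sum, smul_eq_mul, ← mul_assoc,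
    mul_one_div_cancel hK', one_mul]
end
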